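/- Let S_{1,n} be a star graph (n ≥ 1). For any finite simple graph H without isolated vertices, γo(S_{1,n} □ H) ≥ γo(S_{1,n})·γo(H), where γo denotes the global offensive alliance number. -/

import Mathlib

open SimpleGraph

/-- `S` is a global offensive alliance in `G`: every vertex outside `S` has at least
one more neighbor inside `S` than outside `S`. -/
def IsGlobalOffensiveAlliance {V : Type*} (G : SimpleGraph V) (S : Set V) : Prop :=
  ∀ v ∉ S, (G.neighborSet v ∩ S).ncard ≥ (G.neighborSet v \ S).ncard + 1

/-- `S` is a global strong offensive alliance in `G`. -/
def IsGlobalStrongOffensiveAlliance {V : Type*} (G : SimpleGraph V) (S : Set V) : Prop :=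
  ∀ v ∉ S, (G.neighborSet v ∩ S).ncard ≥ (G.neighborSet v \ S).ncard

/-- The global offensive alliance number `γₒ(G)`. -/
noncomputable def globalOffensiveAllianceNumber {V : Type*} (G : SimpleGraph V) : ℕ :=
  sInf {n | ∃ S : Set V, IsGlobalOffensiveAlliance G S ∧ S.ncard = n}

/-- `S` is a dominating set in `G`. -/
def IsDominatingSet {V : Type*} (G : SimpleGraph V) (S : Set V) : Prop :=
  ∀ v ∉ S, ∃ u ∈ S, G.Adj u v

/-- The domination number `γ(G)`. -/
noncomputable def dominationNumber {V : Type*} (G : SimpleGraph V) : ℕ :=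
  sInf {n | ∃ S : Set V, IsDominatingSet G S ∧ S.ncard = n}

/-- `S` is an efficient dominating set: a dominating set whose closed neighborhoods
are pairwise disjoint. -/
def IsEfficientDominatingSet {V : Type*} (G : SimpleGraph V) (S : Set V) : Prop :=
  IsDominatingSet G S ∧
    S.Pairwise fun u w =>
      Disjoint (insert u (G.neighborSet u)) (insert w (G.neighborSet w))

/-- The cardinality of any global offensive alliance bounds `γₒ(G)` from above. -/
theorem IsGlobalOffensiveAlliance.globalOffensiveAllianceNumber_le {V : Type*}
    {G : SimpleGraph V} {S : Set V} (hS : IsGlobalOffensiveAlliance G S) :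
    globalOffensiveAllianceNumber G ≤ S.ncard :=
  Nat.sInf_le ⟨S, hS, rfl⟩

/-- The minimum in the definition of `γₒ(G)` is attained. -/
theorem exists_isGlobalOffensiveAlliance_ncard_eq {V : Type*} (G : SimpleGraph V) :
    ∃ S : Set V, IsGlobalOffensiveAlliance G S ∧ S.ncard = globalOffensiveAllianceNumber G :=
  Nat.sInf_mem (s := {n | ∃ S : Set V, IsGlobalOffensiveAlliance G S ∧ S.ncard = n})
    ⟨_, Set.univ, fun v hv => absurd (Set.mem_univ v) hv, rfl⟩

/-- The projection to `H` of a global offensive alliance in `G □ H` is one in `H`. -/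
theorem IsGlobalOffensiveAlliance.image_snd {V W : Type*} [Finite V] [Nonempty V] [Finite W]
    {G : SimpleGraph V} {H : SimpleGraph W} {S : Set (V × W)}
    (hS : IsGlobalOffensiveAlliance (G.boxProd H) S) :
    IsGlobalOffensiveAlliance H (Prod.snd '' S) := by
  intro w hw
  obtain ⟨g⟩ := ‹Nonempty V›
  have not_mem (g' : V) : (g', w) ∉ S := fun h => hw ⟨_, h, rfl⟩
  have fst_eq_and_adj {x : V × W} (hx : x ∈ (G.boxProd H).neighborSet (g, w) ∩ S) :
      g = x.1 ∧ H.Adj w x.2 := by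
    obtain ⟨hadj, hxS⟩ := hx
    rw [mem_neighborSet, boxProd_adj] at hadj
    rcases hadj with ⟨-, rfl⟩ | ⟨h, h'⟩
    · exact absurd hxS (not_mem x.1)
    · exact ⟨h', h⟩
  have inside_le : ((G.boxProd H).neighborSet (g, w) ∩ S).ncard ≤
      (H.neighborSet w ∩ Prod.snd '' S).ncard :=
    Set.ncard_le_ncard_of_injOn Prod.snd
      (fun x hx => ⟨(fst_eq_and_adj hx).2, x, hx.2, rfl⟩)
      (fun x hx y hy hxy =>
        Prod.ext ((fst_eq_and_adj hx).1.symm.trans (fst_eq_and_adj hy).1) hxy)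
      (Set.toFinite _)
  have outside_le : (H.neighborSet w \ Prod.snd '' S).ncard ≤
      ((G.boxProd H).neighborSet (g, w) \ S).ncard :=
    Set.ncard_le_ncard_of_injOn (Prod.mk g)
      (fun u hu => ⟨boxProd_adj.2 (.inr ⟨hu.1, rfl⟩), fun h => hu.2 ⟨_, h, rfl⟩⟩)
      (fun _ _ _ _ h => (Prod.mk.inj h).2)
      (Set.toFinite _)
  have := hS (g, w) (not_mem g)
  lia

/-- `γₒ(H) ≤ γₒ(G □ H)` for finite graphs with `G` nonempty. -/
theorem globalOffensiveAllianceNumber_le_boxProd {V W : Type*} [Finite V] [Nonempty V] [Finite W]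
    (G : SimpleGraph V) (H : SimpleGraph W) :
    globalOffensiveAllianceNumber H ≤ globalOffensiveAllianceNumber (G.boxProd H) := by
  obtain ⟨S, hS, hcard⟩ := exists_isGlobalOffensiveAlliance_ncard_eq (G.boxProd H)
  calc globalOffensiveAllianceNumber H ≤ (Prod.snd '' S).ncard :=
        hS.image_snd.globalOffensiveAllianceNumber_le
    _ ≤ S.ncard := Set.ncard_image_le (Set.toFinite S)
    _ = _ := hcard

/-- The center of a star is a global offensive alliance. -/
theorem isGlobalOffensiveAlliance_star_center (n : ℕ) :
    IsGlobalOffensiveAlliance (completeBipartiteGraph (Fin 1) (Fin n)) {Sum.inl 0} := by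
  rintro (v | v) hv
  · exact absurd (congrArg Sum.inl (Subsingleton.elim v 0)) hv
  · have nbr : (completeBipartiteGraph (Fin 1) (Fin n)).neighborSet (Sum.inr v) =
        {Sum.inl 0} := by
      ext (u | u)
      · simp [Subsingleton.elim u 0]
      · simp
    simp [nbr]

theorem stmt3 {W : Type*} [Fintype W] [Nonempty W] (n : ℕ) (hn : 1 ≤ n)
    (H : SimpleGraph W) (hH : ∀ v : W, ∃ u : W, H.Adj v u) :
    globalOffensiveAllianceNumber ((completeBipartiteGraph (Fin 1) (Fin n)).boxProd H) ≥
      globalOffensiveAllianceNumber (completeBipartiteGraph (Fin 1) (Fin n)) *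
        globalOffensiveAllianceNumber H := by
  have star_le : globalOffensiveAllianceNumber (completeBipartiteGraph (Fin 1) (Fin n)) ≤ 1 :=
    (isGlobalOffensiveAlliance_star_center n).globalOffensiveAllianceNumber_le.trans_eq
      (Set.ncard_singleton _)
  calc _ ≤ 1 * globalOffensiveAllianceNumber H := Nat.mul_le_mul_right _ star_le
    _ = globalOffensiveAllianceNumber H := one_mul _
    _ ≤ _ := globalOffensiveAllianceNumber_le_boxProd _ H
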